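/- arXiv:1811.01816 — 2 statements merged into one kernel-verified Lean document; each statement's English description precedes it below -/
import Mathlib

section
/- Let L be an n×n real positive semidefinite matrix, let 1 ≤ k ≤ n, and let 0 ≤ α ≤ 1. Then the polynomial Σ_{S ⊆ {1,…,n}, |S| = k} det(L_S)^{(α)}·∏_{i∈S} x_i is strongly log-concave at 𝟙, where L_S is the principal submatrix of L indexed by S, and det(L_S)^{(α)} = det(L_S)^α (real power) if det(L_S) > 0 and 0 if det(L_S) = 0. -/
open MvPolynomial Matrix Finset
open scoped Classical

noncomputable section

abbrev MP (n : ℕ) := MvPolynomial (Fin n) ℝ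

/-- Iterated partial derivative along a list of indices. -/
def derivList {n : ℕ} (l : List (Fin n)) (q : MP n) : MP n :=
  l.foldr (fun i r => pderiv i r) q

/-- Gradient at the all-ones point. -/
def gradOne {n : ℕ} (q : MP n) : Fin n → ℝ := fun i => eval (fun _ => (1:ℝ)) (pderiv i q)

/-- Hessian at the all-ones point. -/
def hessOne {n : ℕ} (q : MP n) : Matrix (Fin n) (Fin n) ℝ :=
  Matrix.of fun i j => eval (fun _ => (1:ℝ)) (pderiv i (pderiv j q))

/-- `q` is log-concave at the all-ones point: `q(𝟙)·∇²q(𝟙) − ∇q(𝟙)∇q(𝟙)ᵀ` is NSD,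
equivalently its negation is PSD. -/
def LogConcaveAtOne {n : ℕ} (q : MP n) : Prop :=
  (vecMulVec (gradOne q) (gradOne q) - eval (fun _ => (1:ℝ)) q • hessOne q).PosSemidef

/-- `q` is strongly log-concave at the all-ones point. -/
def StronglyLogConcaveAtOne {n : ℕ} (q : MP n) : Prop :=
  ∀ l : List (Fin n), LogConcaveAtOne (derivList l q)

/-- The determinant of the principal submatrix of `L` indexed by `S`. -/
def minorDet (n : ℕ) (L : Matrix (Fin n) (Fin n) ℝ) (S : Finset (Fin n)) : ℝ :=
  (L.submatrix (fun i : {x : Fin n // x ∈ S} => (i : Fin n))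
    (fun i : {x : Fin n // x ∈ S} => (i : Fin n))).det

theorem choose_step (a : ℝ) (m : ℕ) :
    Ring.choose a (m+1) = Ring.choose a m * (a - m) / (m + 1) := by
  have h1 := Ring.descPochhammer_eq_factorial_smul_choose a m
  have h2 := Ring.descPochhammer_eq_factorial_smul_choose a (m+1)
  rw [descPochhammer_succ_right, Polynomial.smeval_mul, h1] at h2
  simp only [Polynomial.smeval_sub, Polynomial.smeval_X, Polynomial.smeval_natCast, nsmul_eq_mul, Nat.factorial_succ, pow_one, pow_zero, mul_one] at h2
  push_cast at h2
  have : (m.factorial : ℝ) ≠ 0 := by positivity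
  field_simp
  apply mul_left_cancel₀ this
  linarith

theorem coef_exists (a : ℝ) (ha0 : 0 < a) (ha1 : a ≤ 1) :
    ∃ c : ℕ → ℝ, (∀ m, 0 ≤ c m) ∧
      ∀ t : ℝ, 0 ≤ t → t < 1 → HasSum (fun m => c m * t^(m+1)) (1 - (1-t)^a) := by
  refine ⟨fun m => - (Ring.choose a (m+1) * (-1)^(m+1)), ?_, ?_⟩
  · intro m
    induction m with
    | zero => simp [ha0.le]
    | succ m ih =>
      show 0 ≤ -(Ring.choose a (m + 1 + 1) * (-1) ^ (m + 1 + 1))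
      rw [choose_step]
      have : -(Ring.choose a (m + 1) * (a - ↑(m + 1)) / (↑(m + 1) + 1) * (-1) ^ (m + 1 + 1))
        = (-(Ring.choose a (m + 1) * (-1) ^ (m + 1))) * (((m:ℝ) + 1 - a) / (m + 1 + 1)) := by
        push_cast; ring
      rw [this]
      refine mul_nonneg ih (div_nonneg ?_ (by positivity))
      have : (0:ℝ) ≤ m := by positivity
      linarith
  · intro t ht0 ht1
    have h := (Real.one_add_rpow_hasFPowerSeriesOnBall_zero (a := a)).hasSum (y := -t)
      (by simp [Metric.mem_eball, edist_dist, Real.dist_eq, abs_of_nonneg ht0, ht1])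
    simp only [binomialSeries_apply, List.ofFn_const, List.prod_replicate, smul_eq_mul, zero_add] at h
    rw [← hasSum_nat_add_iff' 1] at h
    simp only [Finset.sum_range_one, Ring.choose_zero_right, pow_zero, mul_one] at h
    have h2 := h.neg
    have e1 : (fun m => -(Ring.choose a (m + 1) * (-1) ^ (m + 1)) * t ^ (m + 1)) =
        fun m => -(Ring.choose a (m + 1) * (-t) ^ (m + 1)) := by
      funext m; rw [neg_pow t]; ring
    have e2 : 1 - (1 - t)^a = -((1 + -t) ^ a - 1) := by
      rw [neg_sub, sub_eq_add_neg 1 t]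
    rw [e2]
    exact e1 ▸ h2

theorem psd_pow {ι : Type*} [Fintype ι] {R : Matrix ι ι ℝ} (hR : R.PosSemidef) (m : ℕ) :
    (Matrix.of fun i j => R i j ^ (m+1)).PosSemidef := by
  induction m with
  | zero =>
    have e : (Matrix.of fun i j => R i j ^ (0+1)) = R := by ext i j; simp
    rw [e]; exact hR
  | succ m ih =>
    have := ih.hadamard hR
    have e : (Matrix.of fun i j => R i j ^ (m+1+1)) =
        (Matrix.of fun i j => R i j ^ (m + 1)) ⊙ R := by
      ext i j; simp [pow_succ]
    rw [e]; exact this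

theorem quad_sum {ι : Type*} [Fintype ι] {R : Matrix ι ι ℝ} (hR : R.PosSemidef) (y : ι → ℝ) :
    0 ≤ ∑ i, ∑ j, y i * y j * R i j := by
  have := hR.dotProduct_mulVec_nonneg y
  simp only [Matrix.mulVec, dotProduct, star_trivial, Finset.mul_sum] at this
  refine this.trans_eq (Finset.sum_congr rfl fun i _ => Finset.sum_congr rfl fun j _ => by ring)

theorem cnd_lt {ι : Type*} [Fintype ι] {R : Matrix ι ι ℝ} (hR : R.PosSemidef)
    (h0 : ∀ i j, 0 ≤ R i j) (h1 : ∀ i j, R i j < 1) (a : ℝ) (ha0 : 0 < a) (ha1 : a ≤ 1)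
    (y : ι → ℝ) : ∑ i, ∑ j, y i * y j * (1 - R i j)^a ≤ (∑ i, y i)^2 := by
  obtain ⟨c, hc, hs⟩ := coef_exists a ha0 ha1
  have : HasSum (fun m => ∑ i, ∑ j, y i * y j * (c m * R i j ^ (m+1)))
      (∑ i, ∑ j, y i * y j * (1 - (1 - R i j)^a)) :=
    hasSum_sum fun i _ => hasSum_sum fun j _ => (hs _ (h0 i j) (h1 i j)).mul_left _
  have h := this.nonneg fun m => by
    have := mul_nonneg (hc m) (quad_sum (psd_pow hR m) y)
    refine this.trans_eq ?_
    simp only [Finset.mul_sum, Matrix.of_apply]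
    exact Finset.sum_congr rfl fun i _ => Finset.sum_congr rfl fun j _ => by ring
  simp only [mul_sub, Finset.sum_sub_distrib, mul_one] at h
  rw [sq, Finset.sum_mul_sum]
  linarith

theorem cnd_le {ι : Type*} [Fintype ι] {R : Matrix ι ι ℝ} (hR : R.PosSemidef)
    (h0 : ∀ i j, 0 ≤ R i j) (h1 : ∀ i j, R i j ≤ 1) (a : ℝ) (ha0 : 0 < a) (ha1 : a ≤ 1)
    (y : ι → ℝ) : ∑ i, ∑ j, y i * y j * (1 - R i j)^a ≤ (∑ i, y i)^2 := by
  have hcont : Continuous fun s : ℝ => ∑ i, ∑ j, y i * y j * (1 - s * R i j)^a := by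
    refine continuous_finsetSum _ fun i _ => continuous_finsetSum _ fun j _ => ?_
    refine continuous_const.mul ?_
    exact (Real.continuous_rpow_const ha0.le).comp (by fun_prop)
  have ht : Filter.Tendsto (fun s : ℝ => ∑ i, ∑ j, y i * y j * (1 - s * R i j)^a)
      (nhdsWithin 1 (Set.Iio 1)) (nhds (∑ i, ∑ j, y i * y j * (1 - 1 * R i j)^a)) :=
    (hcont.tendsto 1).mono_left nhdsWithin_le_nhds
  simp only [one_mul] at ht
  refine le_of_tendsto ht ?_
  have : Set.Ioo (0:ℝ) 1 ∈ nhdsWithin (1:ℝ) (Set.Iio 1) := Ioo_mem_nhdsLT (by norm_num)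
  filter_upwards [this] with s hs
  have := cnd_lt (R := s • R) (hR.smul hs.1.le) (fun i j => mul_nonneg hs.1.le (h0 i j))
    (fun i j => by
      have := h1 i j
      have := h0 i j
      have := hs.1
      have := hs.2
      simp only [Matrix.smul_apply, smul_eq_mul]
      nlinarith) a ha0 ha1 y
  simpa using this

theorem minor_nonneg {ι : Type*} [Fintype ι] {M : Matrix ι ι ℝ} (hM : M.PosSemidef) (i j : ι) :
    M i j ^ 2 ≤ M i i * M j j := by
  have h := (hM.submatrix ![i, j]).det_nonneg
  rw [Matrix.det_fin_two] at h
  have : M j i = M i j := by simpa using hM.1.apply i j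
  simp [this] at h
  nlinarith

theorem power_quad {ι : Type*} [Fintype ι] {M : Matrix ι ι ℝ} (hM : M.PosSemidef)
    (a : ℝ) (ha0 : 0 < a) (ha1 : a ≤ 1) (x : ι → ℝ) :
    ∑ i, ∑ j, x i * x j * (M i i * M j j - M i j ^ 2)^a ≤ (∑ i, (M i i)^a * x i)^2 := by
  have hd : ∀ i, 0 ≤ M i i := fun i => hM.diag_nonneg
  set r : ι → ℝ := fun i => (Real.sqrt (M i i))⁻¹ with hr
  have hr2 : ∀ i, r i ^ 2 = (M i i)⁻¹ := fun i => by
    simp only [hr, inv_pow, Real.sq_sqrt (hd i)]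
  have hC : (Matrix.of fun i j => r i * M i j * r j).PosSemidef := by
    have := hM.mul_mul_conjTranspose_same (Matrix.diagonal r)
    have e : (Matrix.of fun i j => r i * M i j * r j) =
        Matrix.diagonal r * M * (Matrix.diagonal r)ᴴ := by
      ext i j; simp
    rw [e]; exact this
  have hR : (Matrix.of fun i j => (r i * M i j * r j)^2).PosSemidef := psd_pow hC 1
  have hRe : ∀ i j, (r i * M i j * r j)^2 = M i j ^2 / (M i i * M j j) := fun i j => by
    rw [mul_pow, mul_pow, hr2, hr2, div_eq_mul_inv, mul_inv]; ring
  have := cnd_le hR (fun i j => sq_nonneg _) (fun i j => by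
    rw [Matrix.of_apply]
    rw [hRe]
    exact div_le_one_of_le₀ (minor_nonneg hM i j) (mul_nonneg (hd i) (hd j))) a ha0 ha1
    (fun i => (M i i)^a * x i)
  refine le_trans (le_of_eq ?_) this
  refine Finset.sum_congr rfl fun i _ => Finset.sum_congr rfl fun j _ => ?_
  rw [Matrix.of_apply, hRe]
  have e : M i i * M j j - M i j ^ 2 = M i i * M j j * (1 - M i j ^ 2 / (M i i * M j j)) := by
    by_cases h : M i i * M j j = 0
    · have := minor_nonneg hM i j
      have h2 : M i j ^ 2 = 0 := le_antisymm (by linarith) (sq_nonneg _)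
      rw [h2, h]; simp
    · rw [mul_sub, mul_div_cancel₀ _ h, mul_one]
  rw [e, Real.mul_rpow (mul_nonneg (hd i) (hd j)) (sub_nonneg.2 (div_le_one_of_le₀ (minor_nonneg hM i j) (mul_nonneg (hd i) (hd j)))), Real.mul_rpow (hd i) (hd j)]
  ring

theorem spec_aux {ι : Type*} [Fintype ι] (H : ι → ι → ℝ) (w : ι → ℝ) (c : ℝ)
    (hsymm : ∀ i j, H i j = H j i) (h0 : ∀ i j, 0 ≤ H i j) (hpos : ∀ i j, i ≠ j → 0 < H i j)
    (hw : ∀ i, 0 < w i) (hc : 0 < c) (hrow : ∀ i, ∑ j, H i j = c * w i)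
    (hloc : ∀ x : ι → ℝ, c * ∑ i, x i * ∑ j, H i j * x j ≤ ∑ i, (∑ j, H i j * x j)^2 / w i)
    (x : ι → ℝ) :
    (∑ i, w i) * (∑ i, x i * ∑ j, H i j * x j) ≤ c * (∑ i, w i * x i)^2 := by
  set W := ∑ i, w i with hW
  rcases isEmpty_or_nonempty ι with he | he
  · simp
  have hWpos : 0 < W := Finset.sum_pos (fun i _ => hw i) Finset.univ_nonempty
  set s : ι → ℝ := fun i => Real.sqrt (w i) with hs
  have hspos : ∀ i, 0 < s i := fun i => Real.sqrt_pos.2 (hw i)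
  have hss : ∀ i, s i * s i = w i := fun i => Real.mul_self_sqrt (hw i).le
  set E : Matrix ι ι ℝ := Matrix.of fun i j => s i * s j / W - H i j / (c * (s i * s j)) with hE
  have hherm : E.IsHermitian := by
    ext i j
    simp [hE, hsymm i j, mul_comm (s i)]
  have hpsd : E.PosSemidef := by
    rw [hherm.posSemidef_iff_eigenvalues_nonneg]
    intro k
    by_contra hneg
    have hneg : hherm.eigenvalues k < 0 := not_le.1 hneg
    set μ := hherm.eigenvalues k with hμ
    have hev := hherm.mulVec_eigenvectorBasis k
    set v : ι → ℝ := (hherm.eigenvectorBasis k).ofLp with hv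
    have hv0 : v ≠ 0 := by
      intro h
      have := hherm.eigenvectorBasis.orthonormal.ne_zero k
      apply this
      ext i
      exact congrFun h i
    set u : ι → ℝ := fun i => v i / s i with hu
    have hvu : ∀ i, v i = s i * u i := fun i => by
      simp only [hu]; field_simp [(hspos i).ne']
    have e1 : ∀ i, w i / W * (∑ j, w j * u j) - (∑ j, H i j * u j) / c = μ * (w i * u i) := by
      intro i
      have := congrFun hev i
      simp only [Matrix.mulVec, dotProduct, hE, Matrix.of_apply, Pi.smul_apply, smul_eq_mul] at this
      have h2 : s i * ∑ j, (s i * s j / W - H i j / (c * (s i * s j))) * v j = s i * (μ * v i) := by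
        rw [← this]
      rw [hvu i] at h2
      calc _ = s i * ∑ j, (s i * s j / W - H i j / (c * (s i * s j))) * v j := by
            rw [Finset.mul_sum, Finset.mul_sum, Finset.sum_div, ← Finset.sum_sub_distrib]
            refine Finset.sum_congr rfl fun j _ => ?_
            rw [hvu j, ← hss i, ← hss j]
            have := (hspos i).ne'
            have := (hspos j).ne'
            field_simp
        _ = _ := by rw [h2, ← hss i]; ring
    have e2 : ∑ j, w j * u j = 0 := by
      have := Finset.sum_congr (rfl : (Finset.univ : Finset ι) = Finset.univ) (fun i _ => e1 i)
      rw [Finset.sum_sub_distrib, ← Finset.sum_mul, ← Finset.sum_div, ← Finset.sum_div,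
        Finset.sum_comm, ← Finset.mul_sum, ← hW, div_self hWpos.ne'] at this
      have h3 : ∑ y, ∑ x, H x y * u y = c * ∑ j, w j * u j := by
        rw [Finset.mul_sum]
        refine Finset.sum_congr rfl fun j _ => ?_
        rw [← Finset.sum_mul, ← mul_assoc, ← hrow j]
        simp_rw [hsymm]
      rw [h3, mul_div_cancel_left₀ _ hc.ne', one_mul, sub_self] at this
      rcases mul_eq_zero.1 this.symm with h | h
      · exact absurd h hneg.ne
      · exact h
    have e3 : ∀ i, ∑ j, H i j * u j = - (c * μ) * (w i * u i) := by
      intro i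
      have := e1 i
      rw [e2, mul_zero, zero_sub] at this
      field_simp at this
      linarith
    set N := ∑ i, w i * u i ^ 2 with hN
    have hNn : 0 < N := by
      obtain ⟨i, hi⟩ : ∃ i, v i ≠ 0 := by
        by_contra h; push Not at h; exact hv0 (funext h)
      have hui : u i ≠ 0 := div_ne_zero hi (hspos i).ne'
      refine Finset.sum_pos' (fun i _ => by have := hw i; positivity) ⟨i, Finset.mem_univ _, ?_⟩
      have := hw i; positivity
    have e4 : ∑ i, u i * ∑ j, H i j * u j = -(c * μ) * N := by
      rw [hN, Finset.mul_sum]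
      refine Finset.sum_congr rfl fun i _ => ?_
      rw [e3]; ring
    have e5 : ∑ i, (∑ j, H i j * u j)^2 / w i = (c * μ)^2 * N := by
      rw [hN, Finset.mul_sum]
      refine Finset.sum_congr rfl fun i _ => ?_
      have := (hw i).ne'
      rw [e3]; field_simp
    have e6 := hloc u
    rw [e4, e5] at e6
    have e7 : 1 + μ ≤ 0 := by
      by_contra h
      push Not at h
      have : 0 < c^2 * N * (-μ) * (1 + μ) := by
        have : 0 < -μ := by linarith
        positivity
      nlinarith
    have e8 : ∑ i, ∑ j, H i j * (u i - u j)^2 = 2 * c * (1 + μ) * N := by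
      have a1 : ∑ i, ∑ j, H i j * (u i)^2 = c * N := by
        rw [hN, Finset.mul_sum]
        refine Finset.sum_congr rfl fun i _ => ?_
        rw [← Finset.sum_mul, hrow]; ring
      have a2 : ∑ i, ∑ j, H i j * (u j)^2 = c * N := by
        rw [Finset.sum_comm, ← a1]
        simp_rw [hsymm]
      have a3 : ∑ i, ∑ j, H i j * (u i - u j)^2 = ∑ i, ∑ j, H i j * (u i)^2
          + ∑ i, ∑ j, H i j * (u j)^2 - 2 * ∑ i, u i * ∑ j, H i j * u j := by
        simp_rw [Finset.mul_sum, ← Finset.sum_add_distrib, ← Finset.sum_sub_distrib]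
        refine Finset.sum_congr rfl fun i _ => Finset.sum_congr rfl fun j _ => ?_
        ring
      rw [a3, a1, a2, e4]; ring
    have e9 : ∀ i j, u i = u j := by
      intro i j
      by_contra hne
      have hij : i ≠ j := fun h => hne (by rw [h])
      have : 0 < ∑ i, ∑ j, H i j * (u i - u j)^2 := by
        refine Finset.sum_pos' (fun i _ => Finset.sum_nonneg fun j _ => mul_nonneg (h0 i j) (sq_nonneg _)) ⟨i, Finset.mem_univ _, ?_⟩
        refine Finset.sum_pos' (fun j _ => mul_nonneg (h0 i j) (sq_nonneg _)) ⟨j, Finset.mem_univ _, ?_⟩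
        have := hpos i j hij
        have : u i - u j ≠ 0 := sub_ne_zero.2 hne
        positivity
      rw [e8] at this
      have : 2 * c * (1 + μ) * N ≤ 0 := by
        have : 0 ≤ c * N := by positivity
        nlinarith
      linarith
    obtain ⟨i⟩ := he
    have e10 : W * u i = 0 := by
      rw [hW, Finset.sum_mul, ← e2]
      exact Finset.sum_congr rfl fun j _ => by rw [e9 i j]
    have e11 : u i = 0 := (mul_eq_zero.1 e10).resolve_left hWpos.ne'
    have : N = 0 := by
      rw [hN]; exact Finset.sum_eq_zero fun j _ => by rw [e9 j i, e11]; ring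
    linarith
  have key := hpsd.dotProduct_mulVec_nonneg (fun i => s i * x i)
  have e : star (fun i => s i * x i) ⬝ᵥ (E *ᵥ (fun i => s i * x i)) =
      (∑ i, w i * x i)^2 / W - (∑ i, x i * ∑ j, H i j * x j) / c := by
    simp only [Matrix.mulVec, dotProduct, hE, Matrix.of_apply, star_trivial]
    rw [sq, Finset.sum_mul_sum]
    simp_rw [Finset.sum_div, Finset.mul_sum, Finset.sum_div, ← Finset.sum_sub_distrib]
    refine Finset.sum_congr rfl fun i _ => Finset.sum_congr rfl fun j _ => ?_
    rw [← hss i, ← hss j]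
    have := (hspos i).ne'
    have := (hspos j).ne'
    field_simp
  rw [e, sub_nonneg, div_le_div_iff₀ hc hWpos] at key
  linarith

def qq {n : ℕ} (k : ℕ) (f : Finset (Fin n) → ℝ) (T : Finset (Fin n)) : ℝ :=
  ∑ S ∈ Finset.univ.filter (fun S : Finset (Fin n) => S.card = k), if T ⊆ S then f S else 0

def qg {n : ℕ} (k : ℕ) (f : Finset (Fin n) → ℝ) (T : Finset (Fin n)) (i : Fin n) : ℝ :=
  if i ∈ T then 0 else qq k f (insert i T)

def qh {n : ℕ} (k : ℕ) (f : Finset (Fin n) → ℝ) (T : Finset (Fin n)) (i j : Fin n) : ℝ :=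
  if j ∈ T then 0 else qg k f (insert j T) i

def polyT {n : ℕ} (k : ℕ) (f : Finset (Fin n) → ℝ) (T : Finset (Fin n)) : MP n :=
  ∑ S ∈ Finset.univ.filter (fun S : Finset (Fin n) => S.card = k),
    if T ⊆ S then C (f S) * ∏ i ∈ S \ T, X i else 0

theorem pderiv_prodX {n : ℕ} (i : Fin n) (A : Finset (Fin n)) :
    pderiv i (∏ j ∈ A, (X j : MP n)) = if i ∈ A then ∏ j ∈ A.erase i, X j else 0 := by
  induction A using Finset.induction_on with
  | empty => simp
  | insert a A ha ih =>
    rw [Finset.prod_insert ha, Derivation.leibniz, ih, pderiv_X]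
    by_cases hia : a = i
    · subst hia
      simp [ha]
    · have : i ≠ a := fun h => hia h.symm
      by_cases hiA : i ∈ A
      · simp [hiA, hia]
        rw [Finset.erase_insert_of_ne hia, Finset.prod_insert]
        simp [ha]
      · simp [hiA, hia, this]

theorem pderiv_polyT {n : ℕ} (k : ℕ) (f : Finset (Fin n) → ℝ) (T : Finset (Fin n)) (i : Fin n) :
    pderiv i (polyT k f T) = if i ∈ T then 0 else polyT k f (insert i T) := by
  unfold polyT
  rw [map_sum]
  by_cases hi : i ∈ T
  · rw [if_pos hi]
    refine Finset.sum_eq_zero fun S _ => ?_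
    split_ifs with h
    · rw [pderiv_C_mul, pderiv_prodX]; simp [hi]
    · simp
  · rw [if_neg hi]
    refine Finset.sum_congr rfl fun S _ => ?_
    by_cases h : T ⊆ S
    · rw [if_pos h, pderiv_C_mul, pderiv_prodX]
      by_cases hS : i ∈ S
      · have h1 : insert i T ⊆ S := Finset.insert_subset hS h
        rw [if_pos h1, if_pos (by simp [hS, hi])]
        rw [Finset.sdiff_insert]
      · have h1 : ¬ insert i T ⊆ S := fun h' => hS (h' (Finset.mem_insert_self _ _))
        rw [if_neg h1, if_neg (by simp [hS])]; simp
    · have h1 : ¬ insert i T ⊆ S := fun h' => h ((Finset.subset_insert _ _).trans h')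
      rw [if_neg h, if_neg h1]; simp

theorem eval_polyT {n : ℕ} (k : ℕ) (f : Finset (Fin n) → ℝ) (T : Finset (Fin n)) :
    eval (fun _ => (1:ℝ)) (polyT k f T) = qq k f T := by
  unfold polyT qq
  rw [map_sum]
  refine Finset.sum_congr rfl fun S _ => ?_
  split_ifs <;> simp

theorem derivList_polyT {n : ℕ} (k : ℕ) (f : Finset (Fin n) → ℝ) (l : List (Fin n)) :
    derivList l (polyT k f ∅) = 0 ∨ ∃ T, derivList l (polyT k f ∅) = polyT k f T := by
  induction l with
  | nil => exact Or.inr ⟨∅, rfl⟩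
  | cons i l ih =>
    have e : derivList (i :: l) (polyT k f ∅) = pderiv i (derivList l (polyT k f ∅)) := rfl
    rw [e]
    rcases ih with h | ⟨T, h⟩
    · left; rw [h]; simp
    · rw [h, pderiv_polyT]
      split_ifs
      · left; rfl
      · right; exact ⟨_, rfl⟩

theorem qh_symm {n : ℕ} (k : ℕ) (f : Finset (Fin n) → ℝ) (T : Finset (Fin n)) (i j : Fin n) :
    qh k f T i j = qh k f T j i := by
  unfold qh qg
  rw [Finset.insert_comm i j]
  simp only [Finset.mem_insert]
  by_cases h : i = j
  · subst h; rfl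
  · have h' : ¬ j = i := fun h' => h h'.symm
    simp only [h, h', false_or]
    split_ifs <;> rfl

def QuadOK {n : ℕ} (k : ℕ) (f : Finset (Fin n) → ℝ) : Prop :=
  ∀ (T : Finset (Fin n)) (x : Fin n → ℝ),
    qq k f T * (∑ i, x i * ∑ j, qh k f T i j * x j) ≤ (∑ i, qg k f T i * x i)^2

theorem slc_of_quad {n : ℕ} (k : ℕ) (f : Finset (Fin n) → ℝ) (hf : QuadOK k f) :
    StronglyLogConcaveAtOne (∑ S ∈ Finset.univ.filter (fun S : Finset (Fin n) => S.card = k),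
        C (f S) * ∏ i ∈ S, (X i : MP n)) := by
  have e : (∑ S ∈ Finset.univ.filter (fun S : Finset (Fin n) => S.card = k),
        C (f S) * ∏ i ∈ S, (X i : MP n)) = polyT k f ∅ := by
    unfold polyT; simp
  rw [e]
  intro l
  unfold LogConcaveAtOne
  rcases derivList_polyT k f l with h | ⟨T, h⟩
  · rw [h]
    have : (vecMulVec (gradOne (0 : MP n)) (gradOne 0) - eval (fun _ => (1:ℝ)) (0 : MP n) • hessOne 0) = 0 := by
      ext i j
      simp [vecMulVec_apply, gradOne]
    rw [this]
    exact Matrix.PosSemidef.zero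
  · rw [h, eval_polyT]
    have hg : gradOne (polyT k f T) = qg k f T := by
      funext i
      simp only [gradOne, pderiv_polyT, qg]
      split_ifs
      · simp
      · rw [eval_polyT]
    have hh : hessOne (polyT k f T) = Matrix.of (qh k f T) := by
      ext i j
      simp only [hessOne, pderiv_polyT, qh, qg, Matrix.of_apply]
      split_ifs with h1 h2
      · simp
      · rw [pderiv_polyT, if_pos h2]; simp
      · rw [pderiv_polyT, if_neg h2, eval_polyT]
    rw [hg, hh]
    refine .of_dotProduct_mulVec_nonneg ?_ ?_
    · ext i j
      simp [vecMulVec_apply, qh_symm k f T i j, mul_comm]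
    · intro x
      have := hf T x
      rw [← sub_nonneg] at this
      refine this.trans_eq ?_
      simp only [Matrix.mulVec, dotProduct, star_trivial, Matrix.sub_apply, Matrix.smul_apply, vecMulVec_apply, Matrix.of_apply, smul_eq_mul]
      rw [sq, Finset.sum_mul_sum]
      simp_rw [Finset.mul_sum, ← Finset.sum_sub_distrib]
      refine Finset.sum_congr rfl fun i _ => Finset.sum_congr rfl fun j _ => ?_
      ring

theorem qq_cont {n : ℕ} (k : ℕ) (T : Finset (Fin n)) :
    Continuous fun f : Finset (Fin n) → ℝ => qq k f T := by
  unfold qq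
  refine continuous_finsetSum _ fun S _ => ?_
  split_ifs <;> fun_prop

theorem qg_cont {n : ℕ} (k : ℕ) (T : Finset (Fin n)) (i : Fin n) :
    Continuous fun f : Finset (Fin n) → ℝ => qg k f T i := by
  unfold qg
  split_ifs
  · fun_prop
  · exact qq_cont _ _

theorem qh_cont {n : ℕ} (k : ℕ) (T : Finset (Fin n)) (i j : Fin n) :
    Continuous fun f : Finset (Fin n) → ℝ => qh k f T i j := by
  unfold qh
  split_ifs
  · fun_prop
  · exact qg_cont _ _ _

theorem quad_closed {n : ℕ} (k : ℕ) : IsClosed {f : Finset (Fin n) → ℝ | QuadOK k f} := by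
  unfold QuadOK
  simp only [Set.ofPred_forall]
  refine isClosed_iInter fun T => isClosed_iInter fun x => ?_
  have h1 := qq_cont k T
  have h2 := qg_cont k T
  have h3 := qh_cont k T
  exact isClosed_le (by fun_prop) (by fun_prop)

theorem sum_qg {n : ℕ} (k : ℕ) (f : Finset (Fin n) → ℝ) (T : Finset (Fin n)) :
    ∑ i, qg k f T i = ((k:ℝ) - T.card) * qq k f T := by
  have e : ∀ i, qg k f T i = ∑ S ∈ Finset.univ.filter (fun S : Finset (Fin n) => S.card = k),
      if i ∈ S \ T then (if T ⊆ S then f S else 0) else 0 := by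
    intro i
    unfold qg qq
    split_ifs with h
    · symm; apply Finset.sum_eq_zero; intro S _; simp [h]
    · refine Finset.sum_congr rfl fun S _ => ?_
      simp only [Finset.insert_subset_iff, Finset.mem_sdiff, h, not_false_eq_true, and_true]
      by_cases h1 : i ∈ S <;> simp [h1]
  simp_rw [e]
  rw [Finset.sum_comm]
  unfold qq
  rw [Finset.mul_sum]
  refine Finset.sum_congr rfl fun S hS => ?_
  rw [Finset.sum_ite_mem, Finset.univ_inter, Finset.sum_const, nsmul_eq_mul]
  by_cases h : T ⊆ S
  · have hc : S.card = k := (Finset.mem_filter.1 hS).2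
    rw [Finset.card_sdiff_of_subset h, Nat.cast_sub (Finset.card_le_card h), hc]
  · simp [h]

theorem qh_self_mem {n : ℕ} (k : ℕ) (f : Finset (Fin n) → ℝ) (T : Finset (Fin n)) (i j : Fin n)
    (h : i ∈ T ∨ j ∈ T ∨ i = j) : qh k f T i j = 0 := by
  unfold qh qg
  rcases h with h | h | h <;> simp [h]

theorem qh_eq {n : ℕ} (k : ℕ) (f : Finset (Fin n) → ℝ) (T : Finset (Fin n)) (i j : Fin n)
    (hi : i ∉ T) (hj : j ∉ T) (h : i ≠ j) : qh k f T i j = qq k f (insert i (insert j T)) := by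
  unfold qh qg
  simp [h, hi, hj]

theorem sum_qh {n : ℕ} (k : ℕ) (f : Finset (Fin n) → ℝ) (T : Finset (Fin n)) (i : Fin n) :
    ∑ j, qh k f T i j = ((k:ℝ) - T.card - 1) * qg k f T i := by
  simp_rw [qh_symm k f T i]
  unfold qh
  by_cases h : i ∈ T
  · simp [h, qg]
  · simp only [h, if_false, sum_qg, Finset.card_insert_of_notMem h]
    rw [qg, if_neg h]; push_cast; ring

theorem sum_qh3 {n : ℕ} (k : ℕ) (f : Finset (Fin n) → ℝ) (T : Finset (Fin n)) (a b : Fin n) :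
    ∑ i, (if i ∈ T then 0 else qh k f (insert i T) a b) = ((k:ℝ) - T.card - 2) * qh k f T a b := by
  by_cases h : a ∈ T ∨ b ∈ T ∨ a = b
  · rw [qh_self_mem k f T a b h, mul_zero]
    refine Finset.sum_eq_zero fun i _ => ?_
    split_ifs
    · rfl
    · refine qh_self_mem _ _ _ _ _ ?_
      rcases h with h | h | h <;> simp [h]
  · push Not at h
    rw [qh_eq k f T a b h.1 h.2.1 h.2.2]
    have e : ∀ i, (if i ∈ T then 0 else qh k f (insert i T) a b) =
        qg k f (insert a (insert b T)) i := by
      intro i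
      by_cases hi : i ∈ T
      · simp [hi, qg]
      · rw [if_neg hi]
        by_cases hia : i = a
        · subst hia
          rw [qh_self_mem _ _ _ _ _ (by simp)]; simp [qg]
        by_cases hib : i = b
        · subst hib
          rw [qh_self_mem _ _ _ _ _ (by simp)]; simp [qg]
        have := Ne.symm hia
        have := Ne.symm hib
        rw [qh_eq _ _ _ _ _ (by simp [*]) (by simp [*]) h.2.2, qg, if_neg (by simp [*])]
        rw [Finset.insert_comm b i, Finset.insert_comm a i]
    simp_rw [e, sum_qg]
    rw [Finset.card_insert_of_notMem (by simp [h]), Finset.card_insert_of_notMem h.2.1]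
    push_cast; ring

theorem qq_pos {n : ℕ} (k : ℕ) (hkn : k ≤ n) (f : Finset (Fin n) → ℝ) (hf : ∀ S, 0 < f S)
    (T : Finset (Fin n)) (hT : T.card ≤ k) : 0 < qq k f T := by
  obtain ⟨S, h1, h2⟩ := Finset.exists_superset_card_eq hT (by simpa using hkn)
  unfold qq
  refine Finset.sum_pos' (fun S _ => ?_) ⟨S, by simp [h2], ?_⟩
  · split_ifs
    · exact (hf S).le
    · exact le_rfl
  · rw [if_pos h1]; exact hf S

theorem qq_zero {n : ℕ} (k : ℕ) (f : Finset (Fin n) → ℝ)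
    (T : Finset (Fin n)) (hT : k < T.card) : qq k f T = 0 := by
  unfold qq
  refine Finset.sum_eq_zero fun S hS => ?_
  rw [if_neg]
  intro h
  have := Finset.card_le_card h
  have hc : S.card = k := (Finset.mem_filter.1 hS).2
  omega

theorem qq_card {n : ℕ} (k : ℕ) (f : Finset (Fin n) → ℝ)
    (T : Finset (Fin n)) (hT : T.card = k) : qq k f T = f T := by
  unfold qq
  rw [Finset.sum_eq_single T]
  · simp
  · intro S hS hne
    rw [if_neg]
    intro h
    have hc : S.card = k := (Finset.mem_filter.1 hS).2
    exact hne (Finset.eq_of_subset_of_card_le h (by omega)).symm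
  · simp [hT]


theorem sum_off {n : ℕ} (T : Finset (Fin n)) (g : Fin n → ℝ) (hg : ∀ i ∈ T, g i = 0) :
    ∑ i, g i = ∑ i : {i // i ∉ T}, g i := by
  rw [← Finset.sum_subtype (Finset.univ.filter fun i => i ∉ T) (by simp) g]
  symm
  refine Finset.sum_subset (Finset.filter_subset _ _) fun i _ hi => hg i ?_
  simpa using hi

def NN {n : ℕ} (k : ℕ) (f : Finset (Fin n) → ℝ) (T : Finset (Fin n)) : Prop :=
  ∀ x : Fin n → ℝ, ((k:ℝ) - T.card) * qq k f T * (∑ i, x i * ∑ j, qh k f T i j * x j) ≤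
    ((k:ℝ) - T.card - 1) * (∑ i, qg k f T i * x i)^2

theorem NN_step {n : ℕ} (k : ℕ) (hkn : k ≤ n) (f : Finset (Fin n) → ℝ) (hf : ∀ S, 0 < f S)
    (T : Finset (Fin n)) (hT : T.card + 3 ≤ k) (ih : ∀ i, i ∉ T → NN k f (insert i T)) :
    NN k f T := by
  have hd : (3:ℝ) ≤ (k:ℝ) - T.card := by
    have : ((T.card + 3 : ℕ) : ℝ) ≤ k := by exact_mod_cast hT
    push_cast at this; linarith
  have hw : ∀ i, i ∉ T → 0 < qg k f T i := fun i hi => by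
    rw [qg, if_neg hi]
    exact qq_pos k hkn f hf _ (by rw [Finset.card_insert_of_notMem hi]; omega)
  have hg0 : ∀ i ∈ T, qg k f T i = 0 := fun i hi => by rw [qg, if_pos hi]
  have hpos : ∀ i j, i ∉ T → j ∉ T → i ≠ j → 0 < qh k f T i j := fun i j hi hj hij => by
    rw [qh_eq k f T i j hi hj hij]
    refine qq_pos k hkn f hf _ ?_
    rw [Finset.card_insert_of_notMem (by simp [hij, hi]), Finset.card_insert_of_notMem hj]
    omega
  have hrowsub : ∀ (i : Fin n) (X : Fin n → ℝ),
      ∑ j, qh k f T i j * X j = ∑ j : {j // j ∉ T}, qh k f T i j * X j := fun i X =>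
    sum_off T (fun j => qh k f T i j * X j)
      (fun j hj => by rw [qh_self_mem k f T i j (by simp [hj]), zero_mul])
  have hrow0 : ∀ (i : Fin n) (X : Fin n → ℝ), i ∈ T → ∑ j, qh k f T i j * X j = 0 := fun i X hi =>
    Finset.sum_eq_zero fun j _ => by rw [qh_self_mem k f T i j (by simp [hi]), zero_mul]
  have hlocX : ∀ X : Fin n → ℝ, ((k:ℝ) - T.card - 1) * ∑ i, X i * ∑ j, qh k f T i j * X j ≤
      ∑ i, (∑ j, qh k f T i j * X j)^2 / qg k f T i := by
    intro X
    have h1 : ∀ i, ((k:ℝ) - T.card - 1) *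
        (∑ a, X a * ∑ b, (if i ∈ T then 0 else qh k f (insert i T) a b) * X b) ≤
        ((k:ℝ) - T.card - 2) * ((∑ j, qh k f T i j * X j)^2 / qg k f T i) := by
      intro i
      by_cases hi : i ∈ T
      · simp [hi, hg0 i hi]
      · have := ih i hi X
        rw [Finset.card_insert_of_notMem hi] at this
        simp only [if_neg hi]
        have e1 : ∀ a, qg k f (insert i T) a = qh k f T i a := fun a => by
          rw [qh_symm, qh, if_neg hi]
        simp_rw [e1] at this
        have e2 : qq k f (insert i T) = qg k f T i := by rw [qg, if_neg hi]
        rw [e2] at this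
        push_cast at this
        rw [← mul_div_assoc, le_div_iff₀ (hw i hi)]
        linarith
    have h2 := Finset.sum_le_sum fun i (_ : i ∈ Finset.univ) => h1 i
    rw [← Finset.mul_sum, ← Finset.mul_sum] at h2
    have h3 : ∑ i, (∑ a, X a * ∑ b, (if i ∈ T then 0 else qh k f (insert i T) a b) * X b) =
        ((k:ℝ) - T.card - 2) * ∑ i, X i * ∑ j, qh k f T i j * X j := by
      rw [Finset.sum_comm, Finset.mul_sum]
      refine Finset.sum_congr rfl fun a _ => ?_
      rw [← Finset.mul_sum, mul_left_comm, Finset.sum_comm]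
      congr 1
      rw [Finset.mul_sum]
      refine Finset.sum_congr rfl fun b _ => ?_
      rw [← Finset.sum_mul, sum_qh3, mul_assoc]
    rw [h3, mul_left_comm] at h2
    exact le_of_mul_le_mul_left h2 (by linarith)
  intro x
  have key := spec_aux (ι := {i // i ∉ T}) (fun i j => qh k f T i j) (fun i => qg k f T i)
    ((k:ℝ) - T.card - 1) (fun i j => qh_symm _ _ _ _ _)
    (fun i j => by
      by_cases h : i = j
      · rw [qh_self_mem k f T i j (by simp [h])]
      · exact (hpos i j i.2 j.2 (fun h' => h (Subtype.ext h'))).le)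
    (fun i j h => hpos i j i.2 j.2 (fun h' => h (Subtype.ext h')))
    (fun i => hw i i.2) (by linarith)
    (fun i => by
      rw [← sum_qh]
      have := hrowsub i (fun _ => 1)
      simp only [mul_one] at this
      exact this.symm)
    (fun y => by
      have := hlocX (fun i => if h : i ∉ T then y ⟨i, h⟩ else 0)
      rw [sum_off T _ (fun i hi => by rw [hrow0 i _ hi]; simp),
        sum_off T (fun i => (∑ j, qh k f T i j * _)^2 / qg k f T i)
          (fun i hi => by rw [hrow0 i _ hi]; simp)] at this
      simp_rw [hrowsub] at this
      have hy : ∀ i : {i // i ∉ T}, (if h : (i : Fin n) ∉ T then y ⟨i, h⟩ else 0) = y i :=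
        fun i => dif_pos i.2
      simp_rw [hy] at this
      exact this)
    (fun i => x i)
  rw [← sum_qg, sum_off T _ hg0, sum_off T _ (fun i hi => by rw [hrow0 i _ hi]; simp),
    sum_off T (fun i => qg k f T i * x i) (fun i hi => by rw [hg0 i hi]; simp)]
  simp_rw [hrowsub]
  exact key

theorem reverse_cs {ι : Type*} [Fintype ι] (h : ι → ι → ℝ) (hs : ∀ i j, h i j = h j i)
    (l : ι → ℝ) (c : ℝ) (hB : ∀ x : ι → ℝ, ∑ i, x i * ∑ j, h i j * x j ≤ c * (∑ i, l i * x i)^2)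
    (h1 : 0 < ∑ i, ∑ j, h i j) (x : ι → ℝ) :
    (∑ i, ∑ j, h i j) * (∑ i, x i * ∑ j, h i j * x j) ≤ (∑ i, (∑ j, h i j) * x i)^2 := by
  set B := ∑ i, ∑ j, h i j with hBdef
  have hl : ∑ i, l i ≠ 0 := by
    intro h0
    have := hB (fun _ => 1)
    simp only [mul_one, one_mul, h0] at this
    norm_num at this
    linarith
  set t := (∑ i, l i * x i) / ∑ i, l i with ht
  have h2 := hB (fun i => x i - t)
  have e1 : ∑ i, l i * (x i - t) = 0 := by
    simp_rw [mul_sub, Finset.sum_sub_distrib]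
    rw [← Finset.sum_mul, ht, mul_div_cancel₀ _ hl, sub_self]
  have e2 : ∑ i, (x i - t) * ∑ j, h i j * (x j - t) = (∑ i, x i * ∑ j, h i j * x j)
      - 2 * t * (∑ i, (∑ j, h i j) * x i) + t^2 * B := by
    have a1 : ∑ i, ∑ j, h i j * x j = ∑ i, (∑ j, h i j) * x i := by
      rw [Finset.sum_comm]
      refine Finset.sum_congr rfl fun i _ => ?_
      rw [← Finset.sum_mul]
      simp_rw [hs _ i]
    have a2 : ∑ i, (x i - t) * ∑ j, h i j * (x j - t) = ∑ i, (x i * ∑ j, h i j * x j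
        - t * ((∑ j, h i j) * x i) - t * (∑ j, h i j * x j) + t^2 * ∑ j, h i j) := by
      refine Finset.sum_congr rfl fun i _ => ?_
      simp_rw [mul_sub, Finset.sum_sub_distrib, ← Finset.sum_mul]
      ring
    rw [a2, Finset.sum_add_distrib, Finset.sum_sub_distrib, Finset.sum_sub_distrib,
      ← Finset.mul_sum, ← Finset.mul_sum, ← Finset.mul_sum, a1]
    ring
  rw [e1, e2] at h2
  set r := ∑ i, (∑ j, h i j) * x i
  set b := ∑ i, x i * ∑ j, h i j * x j
  nlinarith [sq_nonneg (r - t * B), mul_le_mul_of_nonneg_left h2 h1.le]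

theorem schur_exists {n : ℕ} (L : Matrix (Fin n) (Fin n) ℝ) (hL : L.PosDef) (T : Finset (Fin n)) :
    ∃ M : Matrix (Fin n) (Fin n) ℝ, M.PosSemidef ∧ ∀ i j, i ∉ T → j ∉ T → i ≠ j →
      minorDet n L (insert i (insert j T)) = minorDet n L T * (M i i * M j j - M i j ^ 2) := by
  set v : {x : Fin n // x ∈ T} → Fin n := fun i => (i : Fin n) with hv
  set A := L.submatrix v v with hA
  have hAp : A.PosDef := hL.submatrix Subtype.val_injective
  letI : Invertible A := hAp.isUnit.invertible
  set B : Matrix {x : Fin n // x ∈ T} (Fin n) ℝ := L.submatrix v id with hB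
  have hBt : Bᴴ = L.submatrix id v := by
    rw [hB, Matrix.conjTranspose_submatrix, hL.1]
  set M := L - Bᴴ * A⁻¹ * B with hM
  have hMp : M.PosSemidef := by
    rw [hM, ← Matrix.PosDef.fromBlocks₁₁ B L hAp]
    have : fromBlocks A B Bᴴ L = L.submatrix (Sum.elim v id) (Sum.elim v id) := by
      rw [hBt]
      ext (i | i) (j | j) <;> rfl
    rw [this]
    exact hL.posSemidef.submatrix _
  refine ⟨M, hMp, fun i j hi hj hij => ?_⟩
  have hsym : M j i = M i j := by simpa using hMp.1.apply i j
  let g : {x : Fin n // x ∈ T} ⊕ Fin 2 → {x : Fin n // x ∈ insert i (insert j T)} :=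
    Sum.elim (fun a => ⟨a, by simp [a.2]⟩) ![⟨i, by simp⟩, ⟨j, by simp⟩]
  have hg : Function.Bijective g := by
    constructor
    · rintro (⟨a, ha⟩ | a) (⟨b, hb⟩ | b) h
      · simpa [g] using h
      · fin_cases b
        · simp [g] at h; exact absurd (h ▸ ha) hi
        · simp [g] at h; exact absurd (h ▸ ha) hj
      · fin_cases a
        · simp [g] at h; exact absurd (h ▸ hb) hi
        · simp [g] at h; exact absurd (h ▸ hb) hj
      · fin_cases a <;> fin_cases b <;> simp [g, hij, hij.symm] at h ⊢
    · rintro ⟨a, ha⟩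
      rcases Finset.mem_insert.1 ha with h | h
      · exact ⟨Sum.inr 0, by simp [g, h]⟩
      rcases Finset.mem_insert.1 h with h | h
      · exact ⟨Sum.inr 1, by simp [g, h]⟩
      · exact ⟨Sum.inl ⟨a, h⟩, by simp [g]⟩
  set p : Fin 2 → Fin n := ![i, j] with hp
  have e1 : minorDet n L (insert i (insert j T)) =
      (fromBlocks A (B.submatrix id p) (Bᴴ.submatrix p id) (L.submatrix p p)).det := by
    unfold minorDet
    rw [← Matrix.det_submatrix_equiv_self (Equiv.ofBijective g hg)]
    congr 1
    rw [hBt]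
    ext (a | a) (b | b)
    · rfl
    · fin_cases b <;> rfl
    · fin_cases a <;> rfl
    · fin_cases a <;> fin_cases b <;> rfl
  rw [e1, Matrix.det_fromBlocks₁₁]
  have e2 : L.submatrix p p - Bᴴ.submatrix p id * ⅟A * B.submatrix id p = M.submatrix p p := by
    rw [Matrix.invOf_eq_nonsing_inv]
    ext a b
    simp [hM, Matrix.mul_apply]
  rw [e2, Matrix.det_fin_two]
  have e3 : A.det = minorDet n L T := rfl
  rw [e3]
  simp [hp, hsym]
  left; ring

theorem NN_base {n : ℕ} (k : ℕ) (hkn : k ≤ n) (L : Matrix (Fin n) (Fin n) ℝ) (hL : L.PosDef)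
    (a : ℝ) (ha0 : 0 < a) (ha1 : a ≤ 1) (hpos : ∀ S, 0 < minorDet n L S)
    (T : Finset (Fin n)) (hT : T.card + 2 = k) : NN k (fun S => minorDet n L S ^ a) T := by
  set f : Finset (Fin n) → ℝ := fun S => minorDet n L S ^ a with hf
  have hfp : ∀ S, 0 < f S := fun S => Real.rpow_pos_of_pos (hpos S) _
  obtain ⟨M, hM, hdet⟩ := schur_exists L hL T
  have hd : (k:ℝ) - T.card = 2 := by rw [← hT]; push_cast; ring
  have hB : ∀ x : Fin n → ℝ, ∑ i, x i * ∑ j, qh k f T i j * x j ≤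
      (minorDet n L T ^ a) * (∑ i, (if i ∈ T then 0 else M i i ^ a) * x i)^2 := by
    intro x
    have h := power_quad hM a ha0 ha1 (fun i => if i ∈ T then 0 else x i)
    have h' := mul_le_mul_of_nonneg_left h (hfp T).le
    have e1 : ∑ i, M i i ^ a * (if i ∈ T then 0 else x i) =
        ∑ i, (if i ∈ T then 0 else M i i ^ a) * x i :=
      Finset.sum_congr rfl fun i _ => by split_ifs <;> simp
    rw [e1] at h'
    refine le_trans (le_of_eq ?_) h'
    rw [Finset.mul_sum]
    refine Finset.sum_congr rfl fun i _ => ?_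
    rw [Finset.mul_sum, Finset.mul_sum]
    refine Finset.sum_congr rfl fun j _ => ?_
    by_cases hij : i ∈ T ∨ j ∈ T ∨ i = j
    · rw [qh_self_mem k f T i j hij]
      rcases hij with h | h | h
      · simp [h]
      · simp [h]
      · subst h
        rw [← sq (M i i), sub_self, Real.zero_rpow ha0.ne']; simp
    · push Not at hij
      obtain ⟨hi, hj, hij⟩ := hij
      rw [qh_eq k f T i j hi hj hij, qq_card]
      · simp only [hf, if_neg hi, if_neg hj]
        rw [hdet i j hi hj hij, Real.mul_rpow (hpos T).le (sub_nonneg.2 (minor_nonneg hM i j))]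
        ring
      · rw [Finset.card_insert_of_notMem (by simp [hij, hi]), Finset.card_insert_of_notMem hj]
        omega
  have e2 : ∑ i, ∑ j, qh k f T i j = 2 * qq k f T := by
    simp_rw [sum_qh, ← Finset.mul_sum, sum_qg, hd]; ring
  have hq := qq_pos k hkn f hfp T (by omega)
  intro x
  have := reverse_cs (qh k f T) (qh_symm k f T) _ _ hB (by rw [e2]; positivity) x
  rw [e2] at this
  simp_rw [sum_qh, hd] at this
  rw [hd]
  norm_num at this ⊢
  exact this

theorem quad_posDef {n : ℕ} (k : ℕ) (hkn : k ≤ n) (L : Matrix (Fin n) (Fin n) ℝ) (hL : L.PosDef)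
    (a : ℝ) (ha0 : 0 < a) (ha1 : a ≤ 1) : QuadOK k (fun S => minorDet n L S ^ a) := by
  have hpos : ∀ S, 0 < minorDet n L S := fun S => (hL.submatrix Subtype.val_injective).det_pos
  set f : Finset (Fin n) → ℝ := fun S => minorDet n L S ^ a with hf
  have hfp : ∀ S, 0 < f S := fun S => Real.rpow_pos_of_pos (hpos S) _
  have hN : ∀ m : ℕ, ∀ T : Finset (Fin n), T.card + 2 + m = k → NN k f T := by
    intro m
    induction m with
    | zero => intro T hT; exact NN_base k hkn L hL a ha0 ha1 hpos T hT
    | succ m ih =>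
      intro T hT
      refine NN_step k hkn f hfp T (by omega) fun i hi => ih _ ?_
      rw [Finset.card_insert_of_notMem hi]; omega
  intro T x
  by_cases hT : T.card + 2 ≤ k
  · have h := hN (k - (T.card + 2)) T (by omega) x
    have hq := qq_pos k hkn f hfp T (by omega)
    have hd : (2:ℝ) ≤ (k:ℝ) - T.card := by
      have : ((T.card + 2 : ℕ) : ℝ) ≤ k := by exact_mod_cast hT
      push_cast at this; linarith
    set d := (k:ℝ) - T.card
    have hs := sq_nonneg (∑ i, qg k f T i * x i)
    have : d * (qq k f T * (∑ i, x i * ∑ j, qh k f T i j * x j)) ≤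
        d * (∑ i, qg k f T i * x i)^2 := by nlinarith
    exact le_of_mul_le_mul_left this (by linarith)
  · have : ∀ i j, qh k f T i j = 0 := by
      intro i j
      by_cases hij : i ∈ T ∨ j ∈ T ∨ i = j
      · exact qh_self_mem k f T i j hij
      · push Not at hij
        obtain ⟨hi, hj, hij⟩ := hij
        rw [qh_eq k f T i j hi hj hij]
        apply qq_zero
        rw [Finset.card_insert_of_notMem (by simp [hij, hi]), Finset.card_insert_of_notMem hj]
        omega
    simp only [this]
    simp
    positivity

theorem minorDet_nonneg {n : ℕ} (L : Matrix (Fin n) (Fin n) ℝ) (hL : L.PosSemidef)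
    (S : Finset (Fin n)) : 0 ≤ minorDet n L S := (hL.submatrix _).det_nonneg

theorem quad_posSemidef {n : ℕ} (k : ℕ) (hkn : k ≤ n) (L : Matrix (Fin n) (Fin n) ℝ)
    (hL : L.PosSemidef) (a : ℝ) (ha0 : 0 < a) (ha1 : a ≤ 1) :
    QuadOK k (fun S => minorDet n L S ^ a) := by
  have hcont : Continuous fun e : ℝ => (fun S => minorDet n (L + e • 1) S ^ a) := by
    refine continuous_pi fun S => (Real.continuous_rpow_const ha0.le).comp ?_
    unfold minorDet
    refine Continuous.matrix_det ?_
    refine Continuous.matrix_submatrix ?_ _ _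
    fun_prop
  have ht := (hcont.tendsto 0).mono_left (nhdsWithin_le_nhds (s := Set.Ioi 0))
  simp only [zero_smul, add_zero] at ht
  refine (quad_closed k).mem_of_tendsto ht ?_
  filter_upwards [self_mem_nhdsWithin] with e he
  refine quad_posDef k hkn _ ?_ a ha0 ha1
  exact Matrix.PosDef.posSemidef_add hL (Matrix.PosDef.one.smul he)

theorem quad_all {n : ℕ} (k : ℕ) (hkn : k ≤ n) (L : Matrix (Fin n) (Fin n) ℝ)
    (hL : L.PosSemidef) (a : ℝ) (ha0 : 0 ≤ a) (ha1 : a ≤ 1) :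
    QuadOK k (fun S => if minorDet n L S = 0 then 0 else minorDet n L S ^ a) := by
  have hp : ∀ b : ℝ, 0 < b → b ≤ 1 →
      QuadOK k (fun S => if minorDet n L S = 0 then 0 else minorDet n L S ^ b) := by
    intro b hb0 hb1
    have := quad_posSemidef k hkn L hL b hb0 hb1
    have e : (fun S => if minorDet n L S = 0 then 0 else minorDet n L S ^ b) =
        fun S => minorDet n L S ^ b := by
      funext S
      split_ifs with h
      · rw [h, Real.zero_rpow hb0.ne']
      · rfl
    rw [e]; exact this
  rcases ha0.lt_or_eq with h | h
  · exact hp a h ha1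
  · subst h
    have hcont : Continuous fun b : ℝ =>
        (fun S => if minorDet n L S = 0 then 0 else minorDet n L S ^ b) := by
      refine continuous_pi fun S => ?_
      split_ifs with h
      · fun_prop
      · exact Real.continuous_const_rpow h
    have ht := (hcont.tendsto 0).mono_left (nhdsWithin_le_nhds (s := Set.Ioi 0))
    refine (quad_closed k).mem_of_tendsto ht ?_
    have : Set.Ioo (0:ℝ) 1 ∈ nhdsWithin (0:ℝ) (Set.Ioi 0) := Ioo_mem_nhdsGT (by norm_num)
    filter_upwards [this] with b hb
    exact hp b hb.1 hb.2.le

theorem stmt12 (n k : ℕ) (hk1 : 1 ≤ k) (hkn : k ≤ n)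
    (L : Matrix (Fin n) (Fin n) ℝ) (hL : L.PosSemidef)
    (α : ℝ) (hα0 : 0 ≤ α) (hα1 : α ≤ 1) :
    StronglyLogConcaveAtOne
      (∑ S ∈ Finset.univ.filter (fun S : Finset (Fin n) => S.card = k),
        C (if minorDet n L S = 0 then 0 else minorDet n L S ^ α) * ∏ i ∈ S, X i) := by
  exact slc_of_quad k _ (quad_all k hkn L hL α hα0 hα1)

end
end

section
/- Let p ∈ ℝ[x₁,…,xₙ] be a d-homogeneous polynomial with nonnegative coefficients such that: (1) for every 0 ≤ k ≤ d−2 and every tuple (i₁,…,i_k) ∈ {1,…,n}^k, the polynomial ∂_{i₁}⋯∂_{i_k} p is indecomposable; and (2) for every tuple (i₁,…,i_{d−2}) ∈ {1,…,n}^{d−2}, the quadratic polynomial ∂_{i₁}⋯∂_{i_{d−2}} p is either identically zero or log-concave at 𝟙. Then p is strongly log-concave at 𝟙. -/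
open MvPolynomial Matrix Finset
open scoped Classical

noncomputable section

/-- `p` is decomposable: it is the sum of two nonconstant polynomials in disjoint
sets of variables. -/
def Decomposable {n : ℕ} (p : MP n) : Prop :=
  ∃ I : Finset (Fin n), I.Nonempty ∧ I ≠ Finset.univ ∧
    ∃ g h : MP n, 0 < g.totalDegree ∧ 0 < h.totalDegree ∧
      g.vars ⊆ I ∧ Disjoint h.vars I ∧ p = g + h

lemma aux_spec {n : ℕ} (M : Matrix (Fin n) (Fin n) ℝ) (hM : ∀ i j, M i j = M j i) :
    ∃ (lam : Fin n → ℝ) (v : Fin n → Fin n → ℝ),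
      (∀ k i, ∑ j, M i j * v k j = lam k * v k i) ∧ (∀ k, ∑ i, v k i * v k i = 1) ∧
      ∀ y : Fin n → ℝ, ∑ i, ∑ j, y i * M i j * y j = ∑ k, lam k * (∑ i, v k i * y i) ^ 2 := by
  have hH : M.IsHermitian := by
    ext i j; simp [hM i j]
  have hev : ∀ k i, ∑ j, M i j * hH.eigenvectorBasis k j
      = hH.eigenvalues k * hH.eigenvectorBasis k i := by
    intro k i
    have := congrFun (hH.mulVec_eigenvectorBasis k) i
    simpa [Matrix.mulVec, dotProduct] using this
  refine ⟨hH.eigenvalues, fun k i => hH.eigenvectorBasis k i, hev, ?_, ?_⟩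
  · intro k
    have := hH.eigenvectorBasis.orthonormal.1 k
    have h2 := EuclideanSpace.real_norm_sq_eq (hH.eigenvectorBasis k)
    rw [this] at h2
    simpa [sq] using h2.symm
  · intro y
    have h := hH.eigenvectorBasis.sum_inner_mul_inner (WithLp.toLp 2 y) (WithLp.toLp 2 (M *ᵥ y))
    have h3 : ∀ k, ∑ i, hH.eigenvectorBasis k i * (∑ j, M i j * y j)
        = hH.eigenvalues k * ∑ i, hH.eigenvectorBasis k i * y i := by
      intro k
      simp_rw [Finset.mul_sum]
      rw [Finset.sum_comm]
      refine Finset.sum_congr rfl fun j _ => ?_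
      rw [← mul_assoc, ← hev, Finset.sum_mul]
      refine Finset.sum_congr rfl fun i _ => ?_
      rw [hM j i]; ring
    have h4 : ∀ k, ∑ i, (∑ j, M i j * y j) * hH.eigenvectorBasis k i
        = hH.eigenvalues k * ∑ i, hH.eigenvectorBasis k i * y i := by
      intro k; rw [← h3]; exact Finset.sum_congr rfl fun i _ => mul_comm _ _
    simp only [PiLp.inner_apply, RCLike.inner_apply, conj_trivial, Matrix.mulVec, dotProduct] at h
    simp only [h4] at h
    calc _ = ∑ i, (∑ j, M i j * y j) * y i := by
          refine Finset.sum_congr rfl fun i _ => ?_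
          rw [Finset.sum_mul]
          exact Finset.sum_congr rfl fun j _ => by ring
      _ = _ := by
          rw [← h]
          refine Finset.sum_congr rfl fun k _ => ?_
          ring

lemma aux_core {n : ℕ} (H : Fin n → Fin n → ℝ) (hs : ∀ i j, H i j = H j i)
    (hn : ∀ i j, 0 ≤ H i j)
    (hconn : ∀ z : Fin n → ℝ, (∀ i j, 0 < H i j → z i = z j) →
      ∃ c, ∀ i, 0 < ∑ j, H i j → z i = c)
    (hin : ∀ x : Fin n → ℝ, ∑ i, ∑ j, x i * H i j * x j
      ≤ ∑ i, (∑ j, H i j * x j) ^ 2 / (∑ j, H i j))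
    (y : Fin n → ℝ) (hy : ∑ i, (∑ j, H i j) * y i = 0) :
    ∑ i, ∑ j, y i * H i j * y j ≤ 0 := by
  obtain ⟨w, hw⟩ : ∃ w : Fin n → ℝ, ∀ i, ∑ j, H i j = w i := ⟨_, fun i => rfl⟩
  simp only [hw] at hconn hin hy
  have hw0 : ∀ i, 0 ≤ w i := fun i => hw i ▸ Finset.sum_nonneg fun j _ => hn i j
  have hz : ∀ i j, w i = 0 → H i j = 0 := by
    intro i j h
    rw [← hw] at h
    exact (Finset.sum_eq_zero_iff_of_nonneg (fun j _ => hn i j)).1 h j (Finset.mem_univ _)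
  let u : Fin n → ℝ := fun i => Real.sqrt (w i)
  have huu : ∀ i, u i * u i = w i := fun i => Real.mul_self_sqrt (hw0 i)
  have hu0 : ∀ i, w i ≠ 0 → u i ≠ 0 := by
    intro i h h'; apply h; rw [← huu, h', zero_mul]
  let M : Matrix (Fin n) (Fin n) ℝ := fun i j => (u i)⁻¹ * H i j * (u j)⁻¹
  have hMs : ∀ i j, M i j = M j i := by
    intro i j; simp only [M]; rw [hs i j]; ring
  have hHM : ∀ i j, H i j = u i * M i j * u j := by
    intro i j
    by_cases hi : w i = 0
    · simp [M, hz i j hi]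
    by_cases hj : w j = 0
    · have : H i j = 0 := by rw [hs]; exact hz j i hj
      simp [M, this]
    have := hu0 i hi
    have := hu0 j hj
    simp only [M]
    field_simp
  have hMz : ∀ i j, w i = 0 → M i j = 0 := by
    intro i j h; simp [M, hz i j h]
  obtain ⟨lam, v, hv, hv1, hq⟩ := aux_spec M hMs
  have e1 : ∑ i, ∑ j, y i * H i j * y j = ∑ i, ∑ j, (u i * y i) * M i j * (u j * y j) := by
    refine Finset.sum_congr rfl fun i _ => Finset.sum_congr rfl fun j _ => ?_
    rw [hHM]; ring
  rw [e1, hq (fun i => u i * y i)]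
  refine Finset.sum_nonpos fun k _ => ?_
  by_cases hl : lam k ≤ 0
  · exact mul_nonpos_of_nonpos_of_nonneg hl (sq_nonneg _)
  push Not at hl
  suffices h0 : ∑ i, v k i * (u i * y i) = 0 by rw [h0]; simp
  have hvz : ∀ i, w i = 0 → v k i = 0 := by
    intro i h
    have h' := hv k i
    rw [Finset.sum_eq_zero (fun j _ => by rw [hMz i j h, zero_mul])] at h'
    rcases mul_eq_zero.1 h'.symm with h' | h'
    · exact absurd h' hl.ne'
    · exact h'
  let z : Fin n → ℝ := fun i => (u i)⁻¹ * v k i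
  have huz : ∀ i, v k i = u i * z i := by
    intro i
    by_cases h : w i = 0
    · simp [z, hvz i h]
    · have := hu0 i h
      simp only [z]; field_simp
  have hHz : ∀ i, ∑ j, H i j * z j = lam k * (w i * z i) := by
    intro i
    calc _ = ∑ j, u i * (M i j * v k j) := by
          refine Finset.sum_congr rfl fun j _ => ?_
          rw [hHM, huz]; ring
      _ = _ := by
          rw [← Finset.mul_sum, hv, huz, ← huu]; ring
  have hwz : ∑ i, w i * z i ^ 2 = 1 := by
    rw [← hv1 k]
    refine Finset.sum_congr rfl fun i _ => ?_
    rw [huz, ← huu]; ring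
  have hzHz : ∑ i, ∑ j, z i * H i j * z j = lam k := by
    calc _ = ∑ i, lam k * (w i * z i ^ 2) := by
          refine Finset.sum_congr rfl fun i _ => ?_
          have := hHz i
          calc _ = z i * ∑ j, H i j * z j := by
                rw [Finset.mul_sum]; exact Finset.sum_congr rfl fun j _ => by ring
            _ = _ := by rw [this]; ring
      _ = _ := by rw [← Finset.mul_sum, hwz, mul_one]
  have hl1 : 1 ≤ lam k := by
    have h := hin z
    rw [hzHz] at h
    have : ∑ i, (∑ j, H i j * z j) ^ 2 / w i = lam k ^ 2 := by
      calc _ = ∑ i, lam k ^ 2 * (w i * z i ^ 2) := by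
            refine Finset.sum_congr rfl fun i _ => ?_
            rw [hHz]
            by_cases h : w i = 0
            · simp [h]
            · field_simp
        _ = _ := by rw [← Finset.mul_sum, hwz, mul_one]
    rw [this] at h
    nlinarith
  have hsum : ∑ i, ∑ j, H i j * (z i - z j) ^ 2 = 2 - 2 * lam k := by
    have a1 : ∑ i, ∑ j, H i j * z i ^ 2 = 1 := by
      rw [← hwz]
      refine Finset.sum_congr rfl fun i _ => ?_
      rw [← Finset.sum_mul, hw]
    have a2 : ∑ i, ∑ j, H i j * z j ^ 2 = 1 := by
      rw [Finset.sum_comm, ← a1]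
      refine Finset.sum_congr rfl fun i _ => Finset.sum_congr rfl fun j _ => ?_
      rw [hs]
    calc _ = ∑ i, ∑ j, (H i j * z i ^ 2 + H i j * z j ^ 2 - 2 * (z i * H i j * z j)) := by
          refine Finset.sum_congr rfl fun i _ => Finset.sum_congr rfl fun j _ => ?_
          ring
      _ = _ := by
          simp only [Finset.sum_sub_distrib, Finset.sum_add_distrib, ← Finset.mul_sum]
          rw [a1, a2, hzHz]; ring
  have hedge : ∀ i j, 0 < H i j → z i = z j := by
    have hnn : ∀ i j, 0 ≤ H i j * (z i - z j) ^ 2 := fun i j => mul_nonneg (hn i j) (sq_nonneg _)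
    have hle : ∑ i, ∑ j, H i j * (z i - z j) ^ 2 = 0 :=
      le_antisymm (by rw [hsum]; linarith)
        (Finset.sum_nonneg fun i _ => Finset.sum_nonneg fun j _ => hnn i j)
    intro i j hij
    have b1 := (Finset.sum_eq_zero_iff_of_nonneg
      (fun i _ => Finset.sum_nonneg fun j _ => hnn i j)).1 hle i (Finset.mem_univ _)
    have b2 := (Finset.sum_eq_zero_iff_of_nonneg (fun j _ => hnn i j)).1 b1 j (Finset.mem_univ _)
    rcases mul_eq_zero.1 b2 with b | b
    · exact absurd b hij.ne'
    · exact sub_eq_zero.1 (pow_eq_zero_iff (two_ne_zero) |>.1 b)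
  obtain ⟨c, hc⟩ := hconn z hedge
  calc _ = ∑ i, c * (w i * y i) := by
        refine Finset.sum_congr rfl fun i _ => ?_
        by_cases h : w i = 0
        · rw [hvz i h, h]; ring
        · rw [huz, hc i (lt_of_le_of_ne (hw0 i) (Ne.symm h)), ← huu]; ring
    _ = 0 := by rw [← Finset.mul_sum, hy, mul_zero]

lemma aux_A {n : ℕ} (H : Fin n → Fin n → ℝ) (hs : ∀ i j, H i j = H j i)
    (hn : ∀ i j, 0 ≤ H i j)
    (hy : ∀ y : Fin n → ℝ, ∑ i, (∑ j, H i j) * y i = 0 → ∑ i, ∑ j, y i * H i j * y j ≤ 0)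
    (x : Fin n → ℝ) :
    (∑ i, ∑ j, x i * H i j * x j) * (∑ i, ∑ j, H i j) ≤ (∑ i, (∑ j, H i j) * x i) ^ 2 := by
  set W := ∑ i, ∑ j, H i j with hW
  set B := ∑ i, (∑ j, H i j) * x i with hB
  have hW0 : 0 ≤ W := Finset.sum_nonneg fun i _ => Finset.sum_nonneg fun j _ => hn i j
  rcases hW0.eq_or_lt with h | h
  · rw [← h, mul_zero]; positivity
  have h1 := hy (fun i => x i - B / W) (by
    simp only [mul_sub, Finset.sum_sub_distrib, ← Finset.sum_mul]
    rw [← hB, ← hW]; field_simp; ring)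
  have e1 : ∑ i, ∑ j, H i j * x i = B := by
    rw [hB]; simp only [Finset.sum_mul]
  have e2 : ∑ i, ∑ j, H i j * x j = B := by
    rw [Finset.sum_comm, ← e1]
    refine Finset.sum_congr rfl fun i _ => Finset.sum_congr rfl fun j _ => ?_
    rw [hs]
  have h2 : ∑ i, ∑ j, (x i - B / W) * H i j * (x j - B / W)
      = ∑ i, ∑ j, x i * H i j * x j - (B / W) * B - (B / W) * B + (B / W) ^ 2 * W := by
    calc _ = ∑ i, ∑ j, (x i * H i j * x j - (B / W) * (H i j * x i) - (B / W) * (H i j * x j)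
            + (B / W) ^ 2 * H i j) := by
          refine Finset.sum_congr rfl fun i _ => Finset.sum_congr rfl fun j _ => ?_
          ring
      _ = _ := by
          simp only [Finset.sum_sub_distrib, Finset.sum_add_distrib, ← Finset.mul_sum]
          rw [e1, e2]
  rw [h2] at h1
  have h3 : ∑ i, ∑ j, x i * H i j * x j ≤ B ^ 2 / W := by
    have : (B / W) * B + (B / W) * B - (B / W) ^ 2 * W = B ^ 2 / W := by field_simp; ring
    linarith
  rwa [le_div_iff₀ h] at h3

lemma aux_comm {n : ℕ} (i j : Fin n) (q : MP n) : pderiv i (pderiv j q) = pderiv j (pderiv i q) := by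
  ext m
  rw [coeff_pderiv, coeff_pderiv, coeff_pderiv, coeff_pderiv]
  rcases eq_or_ne i j with rfl | h
  · rfl
  · simp only [add_right_comm m, Finsupp.add_apply, Finsupp.single_eq_of_ne h,
      Finsupp.single_eq_of_ne h.symm]
    push_cast; ring

lemma aux_nn {n : ℕ} (i : Fin n) (q : MP n) (h : ∀ m, 0 ≤ coeff m q) (m) :
    0 ≤ coeff m (pderiv i q) := by
  rw [coeff_pderiv]
  exact mul_nonneg (h _) (by positivity)

lemma aux_eval {n : ℕ} (q : MP n) : eval (fun _ => (1:ℝ)) q = ∑ m ∈ q.support, coeff m q := by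
  rw [eval_eq]; simp

lemma aux_eval_nn {n : ℕ} (q : MP n) (h : ∀ m, 0 ≤ coeff m q) :
    0 ≤ eval (fun _ => (1:ℝ)) q := by
  rw [aux_eval]; exact Finset.sum_nonneg fun m _ => h m

lemma aux_eval_pos {n : ℕ} (q : MP n) (h : ∀ m, 0 ≤ coeff m q) (m) (hm : coeff m q ≠ 0) :
    0 < eval (fun _ => (1:ℝ)) q := by
  rw [aux_eval]
  exact Finset.sum_pos' (fun m _ => h m) ⟨m, mem_support_iff.2 hm, lt_of_le_of_ne (h m) hm.symm⟩

lemma aux_euler {n e : ℕ} (q : MP n) (h : q.IsHomogeneous e) :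
    ∑ i, eval (fun _ => (1:ℝ)) (pderiv i q) = e * eval (fun _ => (1:ℝ)) q := by
  have := congrArg (eval (fun _ => (1:ℝ))) h.sum_X_mul_pderiv
  simpa using this

lemma aux_lc {n : ℕ} (q : MP n) : LogConcaveAtOne q ↔
    ∀ x : Fin n → ℝ, eval (fun _ => (1:ℝ)) q * ∑ i, ∑ j, x i * hessOne q i j * x j
      ≤ (∑ i, gradOne q i * x i) ^ 2 := by
  unfold LogConcaveAtOne
  rw [Matrix.posSemidef_iff_dotProduct_mulVec]
  have key : ∀ x : Fin n → ℝ, star x ⬝ᵥ ((vecMulVec (gradOne q) (gradOne q)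
      - eval (fun _ => (1:ℝ)) q • hessOne q) *ᵥ x) = (∑ i, gradOne q i * x i) ^ 2 -
      eval (fun _ => (1:ℝ)) q * ∑ i, ∑ j, x i * hessOne q i j * x j := by
    intro x
    simp only [Matrix.mulVec, dotProduct, Matrix.sub_apply, Matrix.smul_apply, vecMulVec_apply,
      star_trivial, smul_eq_mul]
    rw [sq, Finset.sum_mul_sum, Finset.mul_sum, ← Finset.sum_sub_distrib]
    refine Finset.sum_congr rfl fun i _ => ?_
    rw [Finset.mul_sum, Finset.mul_sum, ← Finset.sum_sub_distrib]
    refine Finset.sum_congr rfl fun j _ => ?_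
    ring
  constructor
  · rintro ⟨_, h⟩ x
    have := h x
    rw [key] at this
    linarith
  · intro h
    refine ⟨?_, fun x => ?_⟩
    · ext i j
      simp [vecMulVec_apply, hessOne, aux_comm i j, mul_comm]
    · rw [key]; linarith [h x]

lemma aux_row {n e : ℕ} (q : MP n) (h : q.IsHomogeneous e) (i : Fin n) :
    ∑ j, hessOne q i j = ((e - 1 : ℕ) : ℝ) * gradOne q i := by
  have := aux_euler (pderiv i q) h.pderiv
  simp only [hessOne, gradOne, Matrix.of_apply, aux_comm i]
  exact this

lemma aux_hs {n : ℕ} (q : MP n) (i j : Fin n) : hessOne q i j = hessOne q j i := by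
  simp only [hessOne, Matrix.of_apply, aux_comm i]

lemma aux_hn {n : ℕ} (q : MP n) (hnn : ∀ m, 0 ≤ coeff m q) (i j : Fin n) : 0 ≤ hessOne q i j :=
  aux_eval_nn _ (aux_nn _ _ (aux_nn _ _ hnn))

lemma aux_fwd {n e : ℕ} (q : MP n) (hh : q.IsHomogeneous (e + 2)) (hnn : ∀ m, 0 ≤ coeff m q)
    (hlc : LogConcaveAtOne q) (x : Fin n → ℝ) :
    (∑ i, ∑ j, x i * hessOne q i j * x j) * (∑ i, ∑ j, hessOne q i j)
      ≤ (∑ i, (∑ j, hessOne q i j) * x i) ^ 2 := by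
  have hq0 := aux_eval_nn q hnn
  have hW : ∑ i, ∑ j, hessOne q i j = (e + 1) * ((e + 2) * eval (fun _ => (1:ℝ)) q) := by
    simp_rw [aux_row q hh]
    rw [← Finset.mul_sum]
    have := aux_euler q hh
    simp only [gradOne, this]
    push_cast; ring
  rcases hq0.eq_or_lt with h | h
  · rw [hW, ← h, mul_zero, mul_zero, mul_zero]; positivity
  refine aux_A _ (aux_hs q) (aux_hn q hnn) (fun y hy => ?_) x
  have h1 := (aux_lc q).1 hlc y
  have h2 : ∑ i, gradOne q i * y i = 0 := by
    simp_rw [aux_row q hh, mul_assoc] at hy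
    rw [← Finset.mul_sum] at hy
    rcases mul_eq_zero.1 hy with h | h
    · exfalso
      have : ((e + 2 - 1 : ℕ) : ℝ) = e + 1 := by push_cast; simp
      rw [this] at h; exact absurd h (by positivity)
    · exact h
  rw [h2] at h1
  by_contra hc
  push Not at hc
  nlinarith [mul_pos h hc]

lemma aux_bwd {n e : ℕ} (q : MP n) (hh : q.IsHomogeneous (e + 2)) (hnn : ∀ m, 0 ≤ coeff m q)
    (hy : ∀ y : Fin n → ℝ, ∑ i, (∑ j, hessOne q i j) * y i = 0 →
      ∑ i, ∑ j, y i * hessOne q i j * y j ≤ 0) : LogConcaveAtOne q := by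
  rw [aux_lc]
  intro x
  have h := aux_A _ (aux_hs q) (aux_hn q hnn) hy x
  have hW : ∑ i, ∑ j, hessOne q i j = (e + 1) * ((e + 2) * eval (fun _ => (1:ℝ)) q) := by
    simp_rw [aux_row q hh]
    rw [← Finset.mul_sum]
    have := aux_euler q hh
    simp only [gradOne, this]
    push_cast; ring
  have hB : ∑ i, (∑ j, hessOne q i j) * x i = (e + 1) * ∑ i, gradOne q i * x i := by
    simp_rw [aux_row q hh, mul_assoc]
    rw [← Finset.mul_sum]; push_cast; ring
  rw [hW, hB] at h
  set X := ∑ i, ∑ j, x i * hessOne q i j * x j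
  set G := ∑ i, gradOne q i * x i
  set Q := eval (fun _ => (1:ℝ)) q
  have he : (0:ℝ) ≤ e := Nat.cast_nonneg e
  have h' : (e + 1 : ℝ) * ((e + 2) * (Q * X)) ≤ (e + 1) * ((e + 1) * G ^ 2) := by
    calc _ = X * ((e + 1) * ((e + 2) * Q)) := by ring
      _ ≤ _ := h
      _ = _ := by ring
  have h'' := le_of_mul_le_mul_left h' (by positivity)
  have : (e + 2 : ℝ) * (Q * X) ≤ (e + 2) * G ^ 2 := by nlinarith [sq_nonneg G]
  exact le_of_mul_le_mul_left this (by positivity)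

lemma aux_conn {n : ℕ} (q : MP n) (hnn : ∀ m, 0 ≤ coeff m q) (hd : ¬ Decomposable q)
    (z : Fin n → ℝ) (hz : ∀ i j, 0 < hessOne q i j → z i = z j) :
    ∃ c, ∀ i, 0 < ∑ j, hessOne q i j → z i = c := by
  by_contra hcon
  push Not at hcon
  obtain ⟨i0, hi0, -⟩ := hcon 0
  obtain ⟨i1, hi1, hne⟩ := hcon (z i0)
  have hmon : ∀ i, 0 < ∑ j, hessOne q i j → ∃ m, coeff m q ≠ 0 ∧ i ∈ m.support := by
    intro i hi
    by_contra hno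
    push Not at hno
    have h0 : pderiv i q = 0 := by
      ext m
      rw [coeff_pderiv, coeff_zero]
      by_cases hc : coeff (m + Finsupp.single i 1) q = 0
      · rw [hc, zero_mul]
      · exact absurd (by simp) (hno _ hc)
    have : ∑ j, hessOne q i j = 0 := by
      refine Finset.sum_eq_zero fun j _ => ?_
      simp [hessOne, aux_comm i, h0]
    exact hi.ne' this
  have hpair : ∀ m, coeff m q ≠ 0 → ∀ i ∈ m.support, ∀ j ∈ m.support, z i = z j := by
    intro m hm i hi j hj
    rcases eq_or_ne i j with rfl | hij
    · rfl
    apply hz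
    rw [Finsupp.mem_support_iff] at hi hj
    simp only [hessOne, Matrix.of_apply]
    refine aux_eval_pos _ (aux_nn _ _ (aux_nn _ _ hnn))
      (m - Finsupp.single i 1 - Finsupp.single j 1) ?_
    have e : m - Finsupp.single i 1 - Finsupp.single j 1 + Finsupp.single i 1
        + Finsupp.single j 1 = m := by
      ext k
      simp only [Finsupp.add_apply, Finsupp.tsub_apply, Finsupp.single_apply]
      split_ifs <;> subst_vars <;> omega
    rw [coeff_pderiv, coeff_pderiv, e]
    exact mul_ne_zero (mul_ne_zero hm (by positivity)) (by positivity)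
  let I : Finset (Fin n) := Finset.univ.filter fun i => z i = z i0
  let S1 := q.support.filter fun m => m.support ⊆ I
  let S2 := q.support.filter fun m => ¬ m.support ⊆ I
  let g : MP n := ∑ m ∈ S1, monomial m (coeff m q)
  let h : MP n := ∑ m ∈ S2, monomial m (coeff m q)
  have hcoeff : ∀ (S : Finset (Fin n →₀ ℕ)) m,
      coeff m (∑ m ∈ S, monomial m (coeff m q)) = if m ∈ S then coeff m q else 0 := by
    intro S m
    simp [coeff_sum, coeff_monomial]
  have hdeg : ∀ (S : Finset (Fin n →₀ ℕ)) m i, m ∈ S → coeff m q ≠ 0 → i ∈ m.support →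
      0 < totalDegree (∑ m ∈ S, monomial m (coeff m q)) := by
    intro S m i hm hc hi
    have h1 : m ∈ (∑ m ∈ S, monomial m (coeff m q)).support := by
      rw [mem_support_iff, hcoeff, if_pos hm]; exact hc
    refine lt_of_lt_of_le ?_ (le_totalDegree h1)
    rw [Finsupp.mem_support_iff] at hi
    exact lt_of_lt_of_le (Nat.pos_of_ne_zero hi)
      (Finset.single_le_sum (f := fun i => m i) (fun _ _ => Nat.zero_le _)
        (Finsupp.mem_support_iff.2 hi))
  have hvars : ∀ (S : Finset (Fin n →₀ ℕ)) i,
      i ∈ (∑ m ∈ S, monomial m (coeff m q)).vars → ∃ m ∈ S, coeff m q ≠ 0 ∧ i ∈ m.support := by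
    intro S i hi
    rw [mem_vars_iff_mem_support] at hi
    obtain ⟨m, hm, him⟩ := hi
    rw [mem_support_iff, hcoeff] at hm
    by_cases hS : m ∈ S
    · rw [if_pos hS] at hm; exact ⟨m, hS, hm, him⟩
    · rw [if_neg hS] at hm; exact absurd rfl hm
  apply hd
  refine ⟨I, ⟨i0, by simp [I]⟩, ?_, g, h, ?_, ?_, ?_, ?_, ?_⟩
  · intro hI
    have : i1 ∈ I := by rw [hI]; exact Finset.mem_univ _
    exact hne (by simpa [I] using this)
  · obtain ⟨m, hm, him⟩ := hmon i0 hi0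
    refine hdeg S1 m i0 ?_ hm him
    simp only [S1, Finset.mem_filter, mem_support_iff]
    refine ⟨hm, fun j hj => ?_⟩
    simp only [I, Finset.mem_filter, Finset.mem_univ, true_and]
    exact hpair m hm j hj i0 him
  · obtain ⟨m, hm, him⟩ := hmon i1 hi1
    refine hdeg S2 m i1 ?_ hm him
    simp only [S2, Finset.mem_filter, mem_support_iff]
    refine ⟨hm, fun hsub => ?_⟩
    exact hne (by simpa [I] using hsub him)
  · intro i hi
    obtain ⟨m, hm, _, him⟩ := hvars S1 i hi
    exact (Finset.mem_filter.1 hm).2 him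
  · rw [Finset.disjoint_left]
    intro i hi hiI
    obtain ⟨m, hm, hc, him⟩ := hvars S2 i hi
    apply (Finset.mem_filter.1 hm).2
    intro j hj
    simp only [I, Finset.mem_filter, Finset.mem_univ, true_and] at hiI ⊢
    rw [← hiI]
    exact hpair m hc j hj i him
  · conv_lhs => rw [q.as_sum]
    exact (Finset.sum_filter_add_sum_filter_not _ _ _).symm

lemma aux_step {n e : ℕ} (q : MP n) (hh : q.IsHomogeneous (e + 3)) (hnn : ∀ m, 0 ≤ coeff m q)
    (hd : ¬ Decomposable q) (hlc : ∀ i, LogConcaveAtOne (pderiv i q)) : LogConcaveAtOne q := by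
  refine aux_bwd (e := e + 1) q hh hnn ?_
  refine aux_core _ (aux_hs q) (aux_hn q hnn) (aux_conn q hnn hd) ?_
  intro x
  have hhi : ∀ i, (pderiv i q).IsHomogeneous (e + 2) := fun i => hh.pderiv
  have hrow : ∀ i j, ∑ k, hessOne (pderiv i q) j k = (e + 1) * hessOne q i j := by
    intro i j
    rw [aux_row _ (hhi i)]
    simp only [gradOne, hessOne, Matrix.of_apply, aux_comm i j]
    push_cast; ring
  have hsumi : ∀ j k, ∑ i, hessOne (pderiv i q) j k = (e + 1) * hessOne q j k := by
    intro j k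
    rw [← hrow]
    refine Finset.sum_congr rfl fun i _ => ?_
    simp only [hessOne, Matrix.of_apply]
    rw [aux_comm j k (pderiv i q), aux_comm j i q]
  have hone : ∀ i, ∑ j, ∑ k, x j * hessOne (pderiv i q) j k * x k
      ≤ (e + 1) * ((∑ j, hessOne q i j * x j) ^ 2 / ∑ j, hessOne q i j) := by
    intro i
    have h := aux_fwd _ (hhi i) (aux_nn i q hnn) (hlc i) x
    simp only [hrow, mul_assoc] at h
    rw [← Finset.mul_sum, ← Finset.mul_sum] at h
    have hw0 : 0 ≤ ∑ j, hessOne q i j := Finset.sum_nonneg fun j _ => aux_hn q hnn i j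
    rcases hw0.eq_or_lt with hw | hw
    · rw [← hw]
      simp only [div_zero, mul_zero]
      refine le_of_eq (Finset.sum_eq_zero fun j _ => Finset.sum_eq_zero fun k _ => ?_)
      have h1 : hessOne q i j = 0 :=
        (Finset.sum_eq_zero_iff_of_nonneg (fun j _ => aux_hn q hnn i j)).1 hw.symm j
          (Finset.mem_univ _)
      have h2 := hrow i j
      rw [h1, mul_zero] at h2
      rw [(Finset.sum_eq_zero_iff_of_nonneg
        (fun k _ => aux_hn _ (aux_nn i q hnn) j k)).1 h2 k (Finset.mem_univ _)]
      ring
    · rw [← mul_div_assoc, le_div_iff₀ hw]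
      have he : (0:ℝ) < e + 1 := by positivity
      refine le_of_mul_le_mul_left ?_ he
      simp only [mul_assoc]
      calc _ = _ := by ring
        _ ≤ _ := h
        _ = _ := by ring
  have he : (0:ℝ) < e + 1 := by positivity
  refine le_of_mul_le_mul_left ?_ he
  calc _ = ∑ i, ∑ j, ∑ k, x j * hessOne (pderiv i q) j k * x k := by
        symm
        rw [Finset.sum_comm, Finset.mul_sum]
        refine Finset.sum_congr rfl fun j _ => ?_
        rw [Finset.sum_comm, Finset.mul_sum]
        refine Finset.sum_congr rfl fun k _ => ?_
        rw [← Finset.sum_mul, ← Finset.mul_sum, hsumi]; ring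
    _ ≤ _ := Finset.sum_le_sum fun i _ => hone i
    _ = _ := by rw [← Finset.mul_sum]

lemma aux_low {n : ℕ} (q : MP n) (hh : q.IsHomogeneous 1 ∨ q.IsHomogeneous 0) :
    LogConcaveAtOne q := by
  rw [aux_lc]
  have : ∀ i j, hessOne q i j = 0 := by
    intro i j
    simp only [hessOne, Matrix.of_apply]
    have : (pderiv j q).IsHomogeneous 0 := by
      rcases hh with h | h
      · exact h.pderiv
      · exact h.pderiv
    rw [← totalDegree_zero_iff_isHomogeneous, totalDegree_eq_zero_iff_eq_C] at this
    rw [this, pderiv_C, map_zero]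
  intro x
  simp only [this, mul_zero, zero_mul, Finset.sum_const_zero]
  positivity

lemma aux_dl {n d : ℕ} (p : MP n) (hh : p.IsHomogeneous d) (hnn : ∀ m, 0 ≤ coeff m p)
    (l : List (Fin n)) : (derivList l p).IsHomogeneous (d - l.length) ∧
      ∀ m, 0 ≤ coeff m (derivList l p) := by
  induction l with
  | nil => exact ⟨hh, hnn⟩
  | cons i l ih =>
    refine ⟨?_, aux_nn i _ ih.2⟩
    have := ih.1.pderiv (i := i)
    rw [List.length_cons, ← Nat.sub_sub]
    exact this

theorem stmt13 (n d : ℕ) (p : MP n) (hhom : p.IsHomogeneous d)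
    (hnn : ∀ m, 0 ≤ coeff m p)
    (h1 : ∀ l : List (Fin n), l.length ≤ d - 2 → ¬ Decomposable (derivList l p))
    (h2 : ∀ l : List (Fin n), l.length = d - 2 →
      derivList l p = 0 ∨ LogConcaveAtOne (derivList l p)) :
    StronglyLogConcaveAtOne p := by
  have key : ∀ k, ∀ l : List (Fin n), l.length + k = d - 2 → LogConcaveAtOne (derivList l p) := by
    intro k
    induction k with
    | zero =>
      intro l hl
      rcases h2 l (by simpa using hl) with h | h
      · rw [h]; exact aux_low 0 (Or.inl (isHomogeneous_zero _ _ _))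
      · exact h
    | succ k ih =>
      intro l hl
      obtain ⟨ha, hb⟩ := aux_dl p hhom hnn l
      have e : d - l.length = k + 3 := by omega
      rw [e] at ha
      refine aux_step _ ha hb (h1 l (by omega)) fun i => ?_
      exact ih (i :: l) (by simp only [List.length_cons]; omega)
  intro l
  by_cases hl : l.length ≤ d - 2
  · exact key (d - 2 - l.length) l (by omega)
  · obtain ⟨ha, -⟩ := aux_dl p hhom hnn l
    apply aux_low
    have : d - l.length = 1 ∨ d - l.length = 0 := by omega
    rcases this with h | h <;> rw [h] at ha
    · exact Or.inl ha
    · exact Or.inr ha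

end
end
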